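/- arXiv:math/0104247 — 3 statements merged into one kernel-verified Lean document; each statement's English description precedes it below -/
import Mathlib

section
/- Let d, x, y, p, e be integers with p prime, e odd and positive, d squarefree, 3 < d < 2y + 1, such that x^2 + d = 4p and y^2 + d = 4p^e. Set pi = (-y + i*sqrt(d))/2 in the complex numbers. Then pi * conj(pi) = p^e, and there exist signs eps, eta in {1, -1} such that sigma = (x + eps*i*sqrt(d))/2 satisfies sigma * conj(sigma) = p, sigma^e = eta * pi, and sigma lies in Z[pi], i.e. there exist integers a, b with sigma = a + b*pi. -/
open Complex

/-- Every power of a root of `X ^ 2 - x X + p` is an integral combination of `1` and the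
conjugate root. -/
theorem exists_int_combination_pow {x p : ℤ} {s t : ℂ} (hadd : s + t = x) (hmul : s * t = p)
    (n : ℕ) : ∃ c f : ℤ, t ^ n = c + f * s := by
  induction n with
  | zero => exact ⟨1, 0, by simp⟩
  | succ k ih =>
    obtain ⟨c, f, h⟩ := ih
    refine ⟨c * x + f * p, -c, ?_⟩
    rw [pow_succ, h]
    push_cast
    linear_combination (c : ℂ) * hadd + (f : ℂ) * hmul

/-- If `s` and `t` are conjugate quadratic integers of prime norm `p` in an imaginary quadratic
order with unit group `{1, -1}`, then an element of norm `p ^ n` not divisible by `p` is, up to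
sign, the `n`-th power of `s` or of `t`. -/
theorem eq_sign_mul_pow_of_norm_eq_prime_pow {x p : ℤ} (hp : Prime p)
    (hdisc : 4 < 4 * p - x ^ 2) (n : ℕ) (a b : ℤ) (s t : ℂ) (hadd : s + t = x)
    (hmul : s * t = p) (him : s.im ≠ 0) (hnorm : a ^ 2 + a * b * x + p * b ^ 2 = p ^ n)
    (hprim : ¬(p ∣ a ∧ p ∣ b)) :
    ∃ η : ℂ, (η = 1 ∨ η = -1) ∧ ((a + b * s : ℂ) = η * s ^ n ∨ (a + b * s : ℂ) = η * t ^ n) := by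
  induction n generalizing a b s t with
  | zero =>
    have hb : b = 0 := by
      by_contra hb
      have hb1 : 1 ≤ b ^ 2 := Int.add_one_le_iff.mpr (sq_pos_of_ne_zero hb)
      rw [pow_zero] at hnorm
      nlinarith [sq_nonneg (2 * a + b * x), mul_nonneg (sub_nonneg.mpr hb1) (sub_pos.mpr hdisc).le]
    subst hb
    have ha : a = 1 ∨ a = -1 := by simpa using hnorm
    rcases ha with rfl | rfl
    · exact ⟨1, Or.inl rfl, by simp⟩
    · exact ⟨-1, Or.inr rfl, by simp⟩
  | succ k ih =>
    have descent : ∀ (a b : ℤ) (s t : ℂ), s + t = x → s * t = p → s.im ≠ 0 →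
        a ^ 2 + a * b * x + p * b ^ 2 = p ^ (k + 1) → ¬(p ∣ a ∧ p ∣ b) → p ∣ a →
        ∃ η : ℂ, (η = 1 ∨ η = -1) ∧
          ((a + b * s : ℂ) = η * s ^ (k + 1) ∨ (a + b * s : ℂ) = η * t ^ (k + 1)) := by
      rintro _ b s t hadd hmul him hnorm hprim ⟨a, rfl⟩
      have hfactor : ((p * a : ℤ) + b * s : ℂ) = s * (((a * x + b : ℤ) : ℂ) + (-a : ℤ) * s) := by
        push_cast
        linear_combination (-(a : ℂ)) * hmul + (a : ℂ) * s * hadd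
      obtain ⟨η, hη, h | h⟩ := ih (a * x + b) (-a) s t hadd hmul him
        (mul_left_cancel₀ hp.ne_zero (by rw [← pow_succ', ← hnorm]; ring))
        (fun h => hprim ⟨dvd_mul_right _ _, by
          have := dvd_sub h.1 ((dvd_neg.mp h.2).mul_right x)
          simpa using this⟩)
      · exact ⟨η, hη, Or.inl (by rw [hfactor, h]; ring)⟩
      · cases k with
        | zero => exact ⟨η, hη, Or.inl (by rw [hfactor, h]; ring)⟩
        | succ m =>
          exfalso
          obtain ⟨c, f, hcf⟩ := exists_int_combination_pow hadd hmul m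
          obtain ⟨u, rfl⟩ : ∃ u : ℤ, η = u := by
            rcases hη with rfl | rfl
            · exact ⟨1, by simp⟩
            · exact ⟨-1, by simp⟩
          have key : ((p * a : ℤ) + b * s : ℂ) = (p * (u * c) : ℤ) + (p * (u * f) : ℤ) * s := by
            rw [hfactor, h, pow_succ, hcf]
            push_cast
            linear_combination (u : ℂ) * (c + f * s) * hmul
          have himeq := congrArg Complex.im key
          simp only [add_im, mul_im, intCast_im, intCast_re, zero_mul, add_zero, zero_add]
            at himeq
          have hb : b = p * (u * f) := by exact_mod_cast mul_right_cancel₀ him himeq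
          exact hprim ⟨dvd_mul_right _ _, hb ▸ dvd_mul_right _ _⟩
    have hdvd : p ∣ a * (a + b * x) :=
      ⟨p ^ k - b ^ 2, by linear_combination hnorm⟩
    rcases hp.dvd_or_dvd hdvd with ha | ha
    · exact descent a b s t hadd hmul him hnorm hprim ha
    · have hadd' : t + s = x := by rw [add_comm, hadd]
      have him' : t.im ≠ 0 := by
        have := congrArg Complex.im hadd
        simp only [add_im, intCast_im] at this
        intro h
        exact him (by linarith)
      obtain ⟨η, hη, h⟩ := descent (a + b * x) (-b) t s hadd' (by rw [mul_comm, hmul]) him'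
        (by rw [← hnorm]; ring)
        (fun h => hprim ⟨by
          have := dvd_sub h.1 ((dvd_neg.mp h.2).mul_right x)
          simpa using this, dvd_neg.mp h.2⟩) ha
      have hswap : (a + b * s : ℂ) = ((a + b * x : ℤ) : ℂ) + (-b : ℤ) * t := by
        push_cast
        linear_combination (b : ℂ) * hadd
      exact ⟨η, hη, by rw [hswap]; exact h.symm⟩

/-- Lemma 3 (Lacroix): a solution `(x, y, d, p, e)` of the pair of diophantine
equations `x^2 + d = 4p` and `y^2 + d = 4p^e` with `p` prime, `e` odd,
`d` squarefree and `3 < d < 2y + 1` yields algebraic integers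
`π = (-y + i√d)/2` and `σ = (x ± i√d)/2` with `π π̄ = p^e`, `σ σ̄ = p`,
`σ^e = ± π` and `σ ∈ ℤ[π]`. -/
theorem diophantine_pair_gives_descent_data
    (d x y p : ℤ) (e : ℕ) (hp : Prime p) (he : Odd e) (hepos : 0 < e)
    (hdsf : Squarefree d) (hd3 : 3 < d) (hdy : d < 2 * y + 1)
    (h1 : x ^ 2 + d = 4 * p) (h2 : y ^ 2 + d = 4 * p ^ e) :
    (((-(y : ℂ) + Complex.I * Real.sqrt (d : ℝ)) / 2) *
        (starRingEnd ℂ) ((-(y : ℂ) + Complex.I * Real.sqrt (d : ℝ)) / 2) = (p : ℂ) ^ e) ∧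
    ∃ ε η : ℂ, (ε = 1 ∨ ε = -1) ∧ (η = 1 ∨ η = -1) ∧
      (((x : ℂ) + ε * Complex.I * Real.sqrt (d : ℝ)) / 2) *
        (starRingEnd ℂ) (((x : ℂ) + ε * Complex.I * Real.sqrt (d : ℝ)) / 2) = (p : ℂ) ∧
      (((x : ℂ) + ε * Complex.I * Real.sqrt (d : ℝ)) / 2) ^ e =
        η * ((-(y : ℂ) + Complex.I * Real.sqrt (d : ℝ)) / 2) ∧
      ∃ a b : ℤ, ((x : ℂ) + ε * Complex.I * Real.sqrt (d : ℝ)) / 2 =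
        (a : ℂ) + (b : ℂ) * ((-(y : ℂ) + Complex.I * Real.sqrt (d : ℝ)) / 2) := by
  have hd4 : 4 < d := by
    refine lt_of_le_of_ne hd3 ?_
    rintro rfl
    have h := hdsf 2 (by norm_num)
    norm_num [Int.isUnit_iff] at h
  have hd : (0 : ℝ) < d := by exact_mod_cast (by linarith : (0 : ℤ) < d)
  have hsq : ((Real.sqrt (d : ℝ) : ℝ) : ℂ) ^ 2 = d := by
    rw [← ofReal_pow, Real.sq_sqrt hd.le, ofReal_intCast]
  have hr : 0 < Real.sqrt (d : ℝ) := Real.sqrt_pos.mpr hd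
  set r : ℝ := Real.sqrt (d : ℝ)
  have h1c : (x : ℂ) ^ 2 + d = 4 * p := by exact_mod_cast h1
  have h2c : (y : ℂ) ^ 2 + d = 4 * p ^ e := by exact_mod_cast h2
  obtain ⟨m, hm⟩ : (2 : ℤ) ∣ x + y := by
    have h : (2 : ℤ) ∣ (x + y) ^ 2 :=
      ⟨2 * p - d + 2 * p ^ e + x * y, by linear_combination h1 + h2⟩
    exact Int.prime_two.dvd_of_dvd_pow h
  have hmc : (x : ℂ) + y = 2 * m := by exact_mod_cast hm
  have hmul : ((x + I * r) / 2 : ℂ) * ((x - I * r) / 2) = p := by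
    linear_combination (1 / 4 : ℂ) * h1c + (1 / 4 : ℂ) * hsq - (r : ℂ) ^ 2 / 4 * I_sq
  refine ⟨?_, ?_⟩
  · simp only [map_div₀, map_add, map_neg, map_mul, conj_I, conj_ofReal, map_intCast, map_ofNat]
    linear_combination (1 / 4 : ℂ) * h2c + (1 / 4 : ℂ) * hsq - (r : ℂ) ^ 2 / 4 * I_sq
  obtain ⟨η, hη, h⟩ := eq_sign_mul_pow_of_norm_eq_prime_pow hp (x := x) (by linarith) e (-m) 1
    ((x + I * r) / 2) ((x - I * r) / 2) (by ring) hmul (by simp [hr.ne'])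
    (by
      obtain rfl : y = 2 * m - x := by linarith
      linarith)
    (fun h => hp.not_dvd_one h.2)
  have hπ : (((-m : ℤ) : ℂ) + (1 : ℤ) * ((x + I * r) / 2)) = (-(y : ℂ) + I * r) / 2 := by
    push_cast
    linear_combination (1 / 2 : ℂ) * hmc
  rw [hπ] at h
  have hηη : η * η = 1 := by rcases hη with rfl | rfl <;> norm_num
  rcases h with h | h
  · refine ⟨1, η, Or.inl rfl, hη, ?_, ?_, m, 1, ?_⟩
    · simp only [map_div₀, map_add, map_mul, map_one, conj_I, conj_ofReal, map_intCast, map_ofNat]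
      linear_combination hmul
    · rw [h, ← mul_assoc, hηη, one_mul, one_mul]
    · push_cast
      linear_combination (1 / 2 : ℂ) * hmc
  · refine ⟨-1, η, Or.inr rfl, hη, ?_, ?_, x - m, -1, ?_⟩
    · simp only [map_div₀, map_add, map_mul, map_neg, map_one, conj_I, conj_ofReal, map_intCast,
        map_ofNat]
      linear_combination hmul
    · rw [h, ← mul_assoc, hηη, one_mul, neg_one_mul, neg_mul, ← sub_eq_add_neg]
    · push_cast
      linear_combination (-1 / 2 : ℂ) * hmc
end

section
/- Let q >= 2 be an integer, let m be the integer part of 2*sqrt(q), let g >= 1 be an integer, and let alpha_1, ..., alpha_g be complex numbers such that for every i, alpha_i * conj(alpha_i) = q and alpha_i + conj(alpha_i) = -m. Set N = q + 1 - sum_{i=1}^g (alpha_i + conj(alpha_i)) and N_2 = q^2 + 1 - sum_{i=1}^g (alpha_i^2 + conj(alpha_i)^2). If N_2 >= N, then g * (m + m^2 - 2q) <= q^2 - q. -/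
open Finset

/-- Proposition 1 (generalizing Ihara): if `α_1, …, α_g` are complex numbers
with `α_i ᾱ_i = q` and `α_i + ᾱ_i = -m` where `m = ⌊2√q⌋`, and if the counts
`N = q + 1 - Σ (α_i + ᾱ_i)` and `N₂ = q² + 1 - Σ (α_i² + ᾱ_i²)` satisfy
`N₂ ≥ N`, then `g (m + m² - 2q) ≤ q² - q`. -/
theorem serre_weil_bound_genus_restriction
    (q m : ℤ) (hq : 2 ≤ q) (hm : m = ⌊2 * Real.sqrt (q : ℝ)⌋)
    (g : ℕ) (hg : 1 ≤ g) (α : Fin g → ℂ)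
    (habs : ∀ i, α i * (starRingEnd ℂ) (α i) = (q : ℂ))
    (htr : ∀ i, α i + (starRingEnd ℂ) (α i) = -(m : ℂ))
    (N N₂ : ℝ)
    (hN : (N : ℂ) = (q : ℂ) + 1 - ∑ i, (α i + (starRingEnd ℂ) (α i)))
    (hN₂ : (N₂ : ℂ) = (q : ℂ) ^ 2 + 1 - ∑ i, ((α i) ^ 2 + ((starRingEnd ℂ) (α i)) ^ 2))
    (h : N ≤ N₂) :
    (g : ℤ) * (m + m ^ 2 - 2 * q) ≤ q ^ 2 - q := by
  have hsq (i : Fin g) : (α i) ^ 2 + ((starRingEnd ℂ) (α i)) ^ 2 = (m : ℂ) ^ 2 - 2 * q := by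
    linear_combination (α i + (starRingEnd ℂ) (α i) - m) * htr i - 2 * habs i
  simp only [htr, sum_const, card_univ, Fintype.card_fin, nsmul_eq_mul] at hN
  simp only [hsq, sum_const, card_univ, Fintype.card_fin, nsmul_eq_mul] at hN₂
  have hN_real : N = q + 1 - g * -(m : ℝ) := by exact_mod_cast hN
  have hN₂_real : N₂ = (q : ℝ) ^ 2 + 1 - g * ((m : ℝ) ^ 2 - 2 * q) := by exact_mod_cast hN₂
  have key : (g : ℝ) * (m + m ^ 2 - 2 * q) ≤ q ^ 2 - q := by linarith
  exact_mod_cast key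
end

section
/- Let q >= 2 be an integer, let m be the integer part of 2*sqrt(q), let g >= 1 be an integer, and let alpha_1, ..., alpha_g be complex numbers such that alpha_i * conj(alpha_i) = q for all i, alpha_i + conj(alpha_i) = -m for i = 1, ..., g-1, and alpha_g + conj(alpha_g) = -(m - 2). Set N = q + 1 - sum_{i=1}^g (alpha_i + conj(alpha_i)) and N_2 = q^2 + 1 - sum_{i=1}^g (alpha_i^2 + conj(alpha_i)^2). If N_2 >= N, then g * (m + m^2 - 2q) <= q^2 - q - 2 + 4m. -/
open Finset

theorem sq_add_conj_sq {z : ℂ} {q t : ℂ} (hnorm : z * (starRingEnd ℂ) z = q)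
    (htrace : z + (starRingEnd ℂ) z = t) : z ^ 2 + (starRingEnd ℂ) z ^ 2 = t ^ 2 - 2 * q := by
  rw [← hnorm, ← htrace]
  ring

/-- Proposition 4 (genus restriction for defect-2 curves of type
`(m, …, m, m-2)`): if `α_1, …, α_g` are complex numbers with `α_i ᾱ_i = q`,
`α_i + ᾱ_i = -m` for `i < g`, and `α_g + ᾱ_g = -(m - 2)`, where `m = ⌊2√q⌋`,
and if the counts `N = q + 1 - Σ (α_i + ᾱ_i)` and
`N₂ = q² + 1 - Σ (α_i² + ᾱ_i²)` satisfy `N₂ ≥ N`, then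
`g (m + m² - 2q) ≤ q² - q - 2 + 4m`. -/
theorem defect_two_genus_restriction
    (q m : ℤ) (hq : 2 ≤ q) (hm : m = ⌊2 * Real.sqrt (q : ℝ)⌋)
    (g : ℕ) (hg : 1 ≤ g) (α : Fin g → ℂ)
    (habs : ∀ i, α i * (starRingEnd ℂ) (α i) = (q : ℂ))
    (htr : ∀ i : Fin g, (i : ℕ) + 1 < g → α i + (starRingEnd ℂ) (α i) = -(m : ℂ))
    (htrlast : ∀ i : Fin g, (i : ℕ) + 1 = g →
      α i + (starRingEnd ℂ) (α i) = -((m : ℂ) - 2))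
    (N N₂ : ℝ)
    (hN : (N : ℂ) = (q : ℂ) + 1 - ∑ i, (α i + (starRingEnd ℂ) (α i)))
    (hN₂ : (N₂ : ℂ) = (q : ℂ) ^ 2 + 1 - ∑ i, ((α i) ^ 2 + ((starRingEnd ℂ) (α i)) ^ 2))
    (h : N ≤ N₂) :
    (g : ℤ) * (m + m ^ 2 - 2 * q) ≤ q ^ 2 - q - 2 + 4 * m := by
  obtain ⟨n, rfl⟩ : ∃ n, g = n + 1 := ⟨g - 1, by omega⟩
  have trace_init (i : Fin n) := htr i.castSucc (by simp)
  have trace_last := htrlast (Fin.last n) (by simp)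
  have sq_init (i : Fin n) := sq_add_conj_sq (habs i.castSucc) (trace_init i)
  have sq_last := sq_add_conj_sq (habs (Fin.last n)) trace_last
  simp only [Fin.sum_univ_castSucc, trace_init, trace_last, sum_const, card_univ,
    Fintype.card_fin, nsmul_eq_mul] at hN
  simp only [Fin.sum_univ_castSucc, sq_init, sq_last, sum_const, card_univ,
    Fintype.card_fin, nsmul_eq_mul] at hN₂
  have hN' : N = q + 1 - (n * -(m : ℝ) + -((m : ℝ) - 2)) := by exact_mod_cast hN
  have hN₂' : N₂ = (q : ℝ) ^ 2 + 1 -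
      (n * ((-(m : ℝ)) ^ 2 - 2 * q) + ((-((m : ℝ) - 2)) ^ 2 - 2 * q)) := by
    exact_mod_cast hN₂
  have key : ((n + 1 : ℕ) : ℝ) * (m + m ^ 2 - 2 * q) ≤ q ^ 2 - q - 2 + 4 * m := by
    push_cast
    linarith
  exact_mod_cast key
end
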